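/- The components of the flat Thomas-D operator commute: for all indices A, B and every smooth function f on ℝ^{n+2}, D_A(D_B f) = D_B(D_A f), where D_A = 2(X·∂ + n/2)∂_A − X_A □. -/

import Mathlib

noncomputable section

/-- Partial derivative in coordinate direction `A` of a function on `ℝ^m`. -/
def pd {m : ℕ} (A : Fin m) (f : (Fin m → ℝ) → ℝ) : (Fin m → ℝ) → ℝ :=
  fun x => fderiv ℝ f x (Pi.single A 1)

/-- The Euler operator `X·∂`. -/
def euler {m : ℕ} (f : (Fin m → ℝ) → ℝ) : (Fin m → ℝ) → ℝ :=
  fun x => ∑ A, x A * pd A f x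

/-- The Laplacian `□ = η^{AB} ∂_A ∂_B` for the diagonal metric with entries `ε`. -/
def lap {m : ℕ} (ε : Fin m → ℝ) (f : (Fin m → ℝ) → ℝ) : (Fin m → ℝ) → ℝ :=
  fun x => ∑ A, ε A * pd A (pd A f) x

/-- `X² = η_{AB} X^A X^B` for the diagonal metric with entries `ε`. -/
def xsq {m : ℕ} (ε : Fin m → ℝ) (x : Fin m → ℝ) : ℝ :=
  ∑ A, ε A * x A ^ 2

/-- `ε` is a diagonal metric with all entries `±1` and exactly `q` entries equal to `-1`,
i.e. a nondegenerate symmetric bilinear form of signature `(m - q, q)`. -/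
def isSig {m : ℕ} (ε : Fin m → ℝ) (q : ℕ) : Prop :=
  (∀ A, ε A = 1 ∨ ε A = -1) ∧ Nat.card {A : Fin m // ε A = -1} = q

/-- The flat Thomas-D operator `D_A = 2(X·∂ + c)∂_A - X_A □` (with `c = n/2`). -/
def thomasD {m : ℕ} (ε : Fin m → ℝ) (c : ℝ) (A : Fin m) (f : (Fin m → ℝ) → ℝ) :
    (Fin m → ℝ) → ℝ :=
  fun x => 2 * (euler (pd A f) x + c * pd A f x) - ε A * x A * lap ε f x

open scoped ContDiff

section

variable {m : ℕ} {f g : (Fin m → ℝ) → ℝ}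

theorem ContDiff.pd (hf : ContDiff ℝ ∞ f) (A : Fin m) : ContDiff ℝ ∞ (pd A f) :=
  (hf.fderiv_right (m := ∞) (by simp)).clm_apply contDiff_const

theorem ContDiff.coord_mul (hf : ContDiff ℝ ∞ f) (A : Fin m) :
    ContDiff ℝ ∞ (fun x => x A * f x) :=
  (contDiff_apply ℝ ℝ A).mul hf

theorem ContDiff.euler (hf : ContDiff ℝ ∞ f) : ContDiff ℝ ∞ (euler f) :=
  ContDiff.sum fun A _ => (hf.pd A).coord_mul A

theorem ContDiff.lap (hf : ContDiff ℝ ∞ f) (ε : Fin m → ℝ) : ContDiff ℝ ∞ (lap ε f) :=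
  ContDiff.sum fun A _ => contDiff_const.mul ((hf.pd A).pd A)

theorem ContDiff.differentiableAt_of_infty (hf : ContDiff ℝ ∞ f) (x : Fin m → ℝ) :
    DifferentiableAt ℝ f x :=
  hf.differentiable (by simp) x

theorem pd_comm (hf : ContDiff ℝ ∞ f) (A B : Fin m) : pd A (pd B f) = pd B (pd A f) := by
  have hsnd (C D : Fin m) (x) :
      pd C (pd D f) x = fderiv ℝ (fderiv ℝ f) x (Pi.single C 1) (Pi.single D 1) := by
    have hd : DifferentiableAt ℝ (fderiv ℝ f) x :=
      (hf.fderiv_right (m := ∞) (by simp)).differentiable (by simp) x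
    change fderiv ℝ (fun y => fderiv ℝ f y (Pi.single D 1)) x _ = _
    rw [fderiv_clm_apply hd (differentiableAt_const _)]
    simp
  funext x
  rw [hsnd, hsnd]
  have hle : (2 : WithTop ℕ∞) ≤ ∞ := WithTop.coe_le_coe.mpr le_top
  exact (hf.contDiffAt.isSymmSndFDerivAt (by simpa using hle)).eq _ _

theorem pd_add (hf : ContDiff ℝ ∞ f) (hg : ContDiff ℝ ∞ g) (A : Fin m) :
    pd A (f + g) = pd A f + pd A g := by
  funext x
  simp [pd, fderiv_add (hf.differentiableAt_of_infty x) (hg.differentiableAt_of_infty x)]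

theorem pd_smul (hf : ContDiff ℝ ∞ f) (c : ℝ) (A : Fin m) : pd A (c • f) = c • pd A f := by
  funext x
  simp [pd, fderiv_const_smul (hf.differentiableAt_of_infty x)]

theorem pd_sum {ι : Type*} (s : Finset ι) {F : ι → (Fin m → ℝ) → ℝ}
    (hF : ∀ i, ContDiff ℝ ∞ (F i)) (A : Fin m) :
    pd A (fun x => ∑ i ∈ s, F i x) = fun x => ∑ i ∈ s, pd A (F i) x := by
  funext x
  simp [pd, fderiv_fun_sum fun i _ => (hF i).differentiableAt_of_infty x]

theorem pd_coord_mul (hf : ContDiff ℝ ∞ f) (A B : Fin m) :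
    pd A (fun x => x B * f x) =
      (if A = B then (1 : ℝ) else 0) • f + fun x => x B * pd A f x := by
  funext x
  have hx : HasFDerivAt (fun y : Fin m → ℝ => y B)
      (ContinuousLinearMap.proj (R := ℝ) (φ := fun _ : Fin m => ℝ) B) x := hasFDerivAt_apply B x
  have h := hx.fun_mul (hf.differentiableAt_of_infty x).hasFDerivAt
  rw [pd, h.fderiv]
  simp [pd, Pi.single_apply, ite_apply, eq_comm, add_comm]

theorem euler_add (hf : ContDiff ℝ ∞ f) (hg : ContDiff ℝ ∞ g) :
    euler (f + g) = euler f + euler g := by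
  funext x
  simp [euler, pd_add hf hg, mul_add, Finset.sum_add_distrib]

theorem euler_smul (hf : ContDiff ℝ ∞ f) (c : ℝ) : euler (c • f) = c • euler f := by
  funext x
  simp [euler, pd_smul hf, Finset.mul_sum, mul_left_comm]

theorem euler_coord_mul (hf : ContDiff ℝ ∞ f) (B : Fin m) :
    euler (fun x => x B * f x) = fun x => x B * (euler f x + f x) := by
  funext x
  simp [euler, pd_coord_mul hf, ite_apply, mul_add, Finset.sum_add_distrib, Finset.mul_sum,
    mul_left_comm, add_comm]

theorem pd_euler (hf : ContDiff ℝ ∞ f) (A : Fin m) :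
    pd A (euler f) = euler (pd A f) + pd A f := by
  unfold euler
  rw [pd_sum _ fun B => (hf.pd B).coord_mul B]
  funext x
  simp [pd_coord_mul (hf.pd _), ite_apply, Finset.sum_add_distrib, pd_comm hf A, add_comm]

theorem lap_add (hf : ContDiff ℝ ∞ f) (hg : ContDiff ℝ ∞ g) (ε : Fin m → ℝ) :
    lap ε (f + g) = lap ε f + lap ε g := by
  funext x
  simp [lap, pd_add hf hg, pd_add (hf.pd _) (hg.pd _), mul_add, Finset.sum_add_distrib]

theorem lap_smul (hf : ContDiff ℝ ∞ f) (ε : Fin m → ℝ) (c : ℝ) :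
    lap ε (c • f) = c • lap ε f := by
  funext x
  simp [lap, pd_smul hf, pd_smul (hf.pd _), Finset.mul_sum, mul_left_comm]

theorem lap_coord_mul (hf : ContDiff ℝ ∞ f) (ε : Fin m → ℝ) (B : Fin m) :
    lap ε (fun x => x B * f x) = (fun x => x B * lap ε f x) + (2 * ε B) • pd B f := by
  have h (A : Fin m) : pd A (pd A (fun x => x B * f x)) =
      (2 * if A = B then (1 : ℝ) else 0) • pd A f + fun x => x B * pd A (pd A f) x := by
    have hs : ContDiff ℝ ∞ ((if A = B then (1 : ℝ) else 0) • f) := contDiff_const.smul hf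
    rw [pd_coord_mul hf, pd_add hs ((hf.pd A).coord_mul B), pd_smul hf,
      pd_coord_mul (hf.pd A), ← add_assoc, ← add_smul, two_mul]
  funext x
  simp [lap, h, ite_apply, mul_add, Finset.sum_add_distrib, Finset.mul_sum, mul_left_comm,
    add_comm]
  ring

theorem lap_pd (hf : ContDiff ℝ ∞ f) (ε : Fin m → ℝ) (A : Fin m) :
    lap ε (pd A f) = pd A (lap ε f) := by
  unfold lap
  rw [pd_sum _ fun B => contDiff_const.mul ((hf.pd B).pd B)]
  funext x
  refine Finset.sum_congr rfl fun B _ => ?_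
  rw [pd_comm hf B A, pd_comm (hf.pd B) B A]
  exact (congrFun (pd_smul ((hf.pd B).pd B) (ε B) A) x).symm

theorem lap_euler (hf : ContDiff ℝ ∞ f) (ε : Fin m → ℝ) :
    lap ε (euler f) = euler (lap ε f) + (2 : ℝ) • lap ε f := by
  have h (A : Fin m) : pd A (pd A (euler f)) =
      euler (pd A (pd A f)) + (2 : ℝ) • pd A (pd A f) := by
    rw [pd_euler hf, pd_add (hf.pd A).euler (hf.pd A), pd_euler (hf.pd A), add_assoc, two_smul]
  have hl (C : Fin m) (x) : pd C (lap ε f) x = ∑ A, ε A * pd C (pd A (pd A f)) x := by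
    unfold lap
    rw [pd_sum _ fun B => contDiff_const.mul ((hf.pd B).pd B)]
    exact Finset.sum_congr rfl fun B _ => congrFun (pd_smul ((hf.pd B).pd B) (ε B) C) x
  funext x
  simp only [lap, h, Pi.add_apply, Pi.smul_apply, smul_eq_mul, mul_add, Finset.sum_add_distrib,
    Finset.mul_sum]
  congr 1
  · simp only [euler, hl, Finset.mul_sum]
    rw [Finset.sum_comm]
    simp only [mul_left_comm]
  · simp only [mul_left_comm]

theorem thomasD_eq (ε : Fin m → ℝ) (c : ℝ) (A : Fin m) (f : (Fin m → ℝ) → ℝ) :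
    thomasD ε c A f =
      (2 : ℝ) • euler (pd A f) + (2 * c) • pd A f + (-ε A) • fun x => x A * lap ε f x := by
  funext x
  simp [thomasD]
  ring

/-- The composition `D_A D_B` for `A ≠ B`, with coordinates moved to the left. -/
theorem thomasD_thomasD (hf : ContDiff ℝ ∞ f) (ε : Fin m → ℝ) (c : ℝ) {A B : Fin m}
    (hAB : A ≠ B) (hB : ε B * ε B = 1) (x : Fin m → ℝ) :
    thomasD ε c A (thomasD ε c B f) x =
      4 * (euler (euler (pd A (pd B f))) x + (2 * c + 1) * euler (pd A (pd B f)) x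
        + c * (c + 1) * pd A (pd B f) x)
      - 2 * ε B * x B * (euler (pd A (lap ε f)) x + (c + 1) * pd A (lap ε f) x)
      - 2 * ε A * x A * (euler (pd B (lap ε f)) x + (c + 1) * pd B (lap ε f) x)
      + ε A * x A * (ε B * x B) * lap ε (lap ε f) x := by
  have hl := hf.lap ε
  have hb := hf.pd B
  have hab := hb.pd A
  have s1 : ContDiff ℝ ∞ ((2 : ℝ) • euler (pd B f)) := contDiff_const.smul hb.euler
  have s2 : ContDiff ℝ ∞ ((2 * c) • pd B f) := contDiff_const.smul hb
  have s3 : ContDiff ℝ ∞ ((-ε B) • fun x => x B * lap ε f x) :=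
    contDiff_const.smul (hl.coord_mul B)
  have s12 : ContDiff ℝ ∞ ((2 : ℝ) • euler (pd B f) + (2 * c) • pd B f) := s1.add s2
  have hpd : pd A (thomasD ε c B f) = (2 : ℝ) • euler (pd A (pd B f))
      + (2 * c + 2) • pd A (pd B f) + (-ε B) • fun x => x B * pd A (lap ε f) x := by
    rw [thomasD_eq, pd_add s12 s3, pd_add s1 s2, pd_smul hb.euler, pd_smul hb,
      pd_smul (hl.coord_mul B), pd_euler hb, pd_coord_mul hl, if_neg hAB]
    module
  have t1 : ContDiff ℝ ∞ ((2 : ℝ) • euler (pd A (pd B f))) := contDiff_const.smul hab.euler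
  have t2 : ContDiff ℝ ∞ ((2 * c + 2) • pd A (pd B f)) := contDiff_const.smul hab
  have t3 : ContDiff ℝ ∞ ((-ε B) • fun x => x B * pd A (lap ε f) x) :=
    contDiff_const.smul ((hl.pd A).coord_mul B)
  have t12 : ContDiff ℝ ∞ ((2 : ℝ) • euler (pd A (pd B f)) + (2 * c + 2) • pd A (pd B f)) :=
    t1.add t2
  have heuler : euler (pd A (thomasD ε c B f)) = (2 : ℝ) • euler (euler (pd A (pd B f)))
      + (2 * c + 2) • euler (pd A (pd B f))
      + (-ε B) • fun x => x B * (euler (pd A (lap ε f)) x + pd A (lap ε f) x) := by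
    rw [hpd, euler_add t12 t3, euler_add t1 t2, euler_smul hab.euler, euler_smul hab,
      euler_smul ((hl.pd A).coord_mul B), euler_coord_mul (hl.pd A)]
  have hlap : lap ε (thomasD ε c B f) = (2 : ℝ) • euler (pd B (lap ε f))
      + (2 * c + 2) • pd B (lap ε f) + (-ε B) • fun x => x B * lap ε (lap ε f) x := by
    rw [thomasD_eq, lap_add s12 s3, lap_add s1 s2, lap_smul hb.euler, lap_smul hb,
      lap_smul (hl.coord_mul B), lap_euler hb, lap_pd hf, lap_coord_mul hl, smul_add, smul_add,
      smul_smul, smul_smul, show -ε B * (2 * ε B) = -2 by linear_combination -2 * hB]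
    module
  rw [thomasD, heuler, hpd, hlap]
  simp only [Pi.add_apply, Pi.smul_apply, smul_eq_mul]
  ring

end

/-- the components of the flat Thomas-D operator
`D_A = 2(X·∂ + n/2)∂_A - X_A □` commute on smooth functions on `ℝ^{n+2}`. -/
theorem thomasD_comm
    (n : ℕ) (hn : 1 ≤ n) (ε : Fin (n + 2) → ℝ) (hsig : isSig ε 2)
    (f : (Fin (n + 2) → ℝ) → ℝ) (hf : ContDiff ℝ (⊤ : ℕ∞) f) :
    ∀ (A B : Fin (n + 2)) (x : Fin (n + 2) → ℝ),
      thomasD ε ((n : ℝ) / 2) A (thomasD ε ((n : ℝ) / 2) B f) x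
        = thomasD ε ((n : ℝ) / 2) B (thomasD ε ((n : ℝ) / 2) A f) x := by
  intro A B x
  obtain rfl | hAB := eq_or_ne A B
  · rfl
  have hsq (C : Fin (n + 2)) : ε C * ε C = 1 := by
    rcases hsig.1 C with h | h <;> simp [h]
  rw [thomasD_thomasD hf ε _ hAB (hsq B), thomasD_thomasD hf ε _ hAB.symm (hsq A),
    pd_comm hf B A]
  ring

end
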